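/- Let T be an ℝ-tree and let G be a group with a non-nesting action on T by weak homeomorphisms. If g ∈ G is elliptic and x ∈ T does not lie in the fixed-point set T^g, then [x, g(x)] ∩ T^g = {a}, where a is the projection of x onto the closed convex set T^g. -/

import Mathlib

open Set

/-- A topologically embedded arc in `T` joining `x` to `y`, given as a subset:
the image of a continuous injective map on `[0,1]` with endpoints `x` and `y`
(such a map is automatically a topological embedding). -/
def IsArc {T : Type*} [MetricSpace T] (A : Set T) (x y : T) : Prop :=
  ∃ f : ℝ → T, ContinuousOn f (Icc (0 : ℝ) 1) ∧ InjOn f (Icc (0 : ℝ) 1) ∧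
    f '' Icc (0 : ℝ) 1 = A ∧ f 0 = x ∧ f 1 = y

/-- `A ⊆ T` is isometric to a closed bounded interval of `ℝ`. -/
def IsIsometricToInterval {T : Type*} [MetricSpace T] (A : Set T) : Prop :=
  ∃ (a b : ℝ) (f : ℝ → T), a ≤ b ∧
    (∀ s ∈ Icc a b, ∀ t ∈ Icc a b, dist (f s) (f t) = |s - t|) ∧
    f '' Icc a b = A

/-- An `ℝ`-tree: a metric space in which any two distinct points are joined by a
unique topologically embedded arc, and this arc is isometric to a closed bounded
interval of `ℝ`. -/
structure IsRTree (T : Type*) [MetricSpace T] : Prop where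
  arc_existsUnique : ∀ ⦃x y : T⦄, x ≠ y → ∃! A : Set T, IsArc A x y
  arc_isometric : ∀ ⦃x y : T⦄, x ≠ y → ∀ A : Set T, IsArc A x y → IsIsometricToInterval A

open scoped Classical in
/-- The segment `[x,y]`: the unique arc joining `x` to `y` if `x ≠ y`
(computed as the intersection of all such arcs), and `{x}` if `x = y`. -/
noncomputable def seg {T : Type*} [MetricSpace T] (x y : T) : Set T :=
  if x = y then {x} else ⋂₀ {A : Set T | IsArc A x y}

/-- Betweenness: `Btwn x y z` iff `x ∈ [y,z] \ {y,z}`. -/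
def Btwn {T : Type*} [MetricSpace T] (x y z : T) : Prop :=
  x ∈ seg y z ∧ x ≠ y ∧ x ≠ z

/-- A weak homeomorphism of `T`: a bijection preserving the betweenness relation. -/
def IsWeakHomeo {T : Type*} [MetricSpace T] (g : T → T) : Prop :=
  Function.Bijective g ∧ ∀ x y z : T, Btwn x y z ↔ Btwn (g x) (g y) (g z)

/-- Convex subsets (subtrees) of `T`. -/
def ConvexSubtree {T : Type*} [MetricSpace T] (S : Set T) : Prop :=
  ∀ x ∈ S, ∀ y ∈ S, seg x y ⊆ S

/-- The action of `G` on `T` is by weak homeomorphisms. -/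
def ActsByWeakHomeos (G T : Type*) [Group G] [MulAction G T] [MetricSpace T] : Prop :=
  ∀ g : G, IsWeakHomeo (fun t : T => g • t)

/-- The action of `G` on `T` is non-nesting: no segment is mapped properly into itself. -/
def NonNesting (G T : Type*) [Group G] [MulAction G T] [MetricSpace T] : Prop :=
  ∀ (g : G) (x y : T), ¬ ((fun t : T => g • t) '' seg x y ⊂ seg x y)

/-- The fixed-point set `T^g` of a group element. -/
def fixedSet (T : Type*) {G : Type*} [Group G] [MulAction G T] (g : G) : Set T :=
  {t : T | g • t = t}

/-- `x, y, z` span a tripod: the median of `x, y, z` lies in none of `{x,y,z}`. -/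
def IsTripod {T : Type*} [MetricSpace T] (x y z : T) : Prop :=
  ∀ c ∈ seg x y ∩ seg y z ∩ seg z x, c ≠ x ∧ c ≠ y ∧ c ≠ z

/-- `S` contains no tripod. -/
def NoTripod {T : Type*} [MetricSpace T] (S : Set T) : Prop :=
  ¬ ∃ x y z : T, IsTripod x y z ∧ seg x y ∪ seg y z ∪ seg z x ⊆ S

/-- A line: a convex subset containing no tripod, maximal for inclusion. -/
def IsLine {T : Type*} [MetricSpace T] (L : Set T) : Prop :=
  ConvexSubtree L ∧ NoTripod L ∧
    ∀ L' : Set T, ConvexSubtree L' → NoTripod L' → L ⊆ L' → L' = L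

/-- `L` is an axis for `g`: a `g`-invariant line. -/
def IsAxis {G T : Type*} [Group G] [MulAction G T] [MetricSpace T] (g : G) (L : Set T) :
    Prop :=
  IsLine L ∧ (fun t : T => g • t) '' L = L



theorem seg_eq_of_isArc {T : Type*} [MetricSpace T] (hT : IsRTree T) {x y : T} (h : x ≠ y)
    {A : Set T} (hA : IsArc A x y) : seg x y = A := by
  unfold seg
  rw [if_neg h]
  have : {B : Set T | IsArc B x y} = {A} := by
    ext B
    exact ⟨fun hB => (hT.arc_existsUnique h).unique hB hA, fun hB => by rw [mem_singleton_iff.1 hB]; exact hA⟩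
  rw [this, sInter_singleton]

theorem seg_eq_image {T : Type*} [MetricSpace T] (hT : IsRTree T) (f : ℝ → T) (a b : ℝ)
    (hab : a < b) (hc : ContinuousOn f (Icc a b)) (hi : InjOn f (Icc a b)) :
    seg (f a) (f b) = f '' Icc a b := by
  have hne : f a ≠ f b := fun h =>
    hab.ne (hi (left_mem_Icc.2 hab.le) (right_mem_Icc.2 hab.le) h)
  have hd : 0 < b - a := by linarith
  apply seg_eq_of_isArc hT hne
  have hm : MapsTo (fun t : ℝ => a + t * (b - a)) (Icc 0 1) (Icc a b) := by
    rintro t ⟨h0, h1⟩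
    constructor <;> nlinarith
  refine ⟨fun t => f (a + t * (b - a)), ?_, ?_, ?_, by simp, by simp⟩
  · exact hc.comp (by fun_prop) hm
  · intro s hs t ht h
    have := hi (hm hs) (hm ht) h
    have h2 : s * (b - a) = t * (b - a) := by linarith
    exact mul_right_cancel₀ hd.ne' h2
  · ext z
    constructor
    · rintro ⟨t, ht, rfl⟩
      exact ⟨_, hm ht, rfl⟩
    · rintro ⟨u, ⟨h0, h1⟩, rfl⟩
      refine ⟨(u - a) / (b - a), ⟨by apply div_nonneg <;> linarith, ?_⟩, ?_⟩
      · rw [div_le_one hd]; linarith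
      · simp only
        congr 1
        field_simp
        ring

theorem continuousOn_of_isom {T : Type*} [MetricSpace T] (f : ℝ → T) (S : Set ℝ)
    (h : ∀ s ∈ S, ∀ t ∈ S, dist (f s) (f t) = |s - t|) : ContinuousOn f S ∧ InjOn f S := by
  constructor
  · have : LipschitzOnWith 1 f S := by
      apply LipschitzOnWith.of_dist_le_mul
      intro s hs t ht
      rw [h s hs t ht, Real.dist_eq]; simp
    exact this.continuousOn
  · intro s hs t ht e
    have := h s hs t ht
    rw [e, dist_self] at this
    have := abs_eq_zero.1 this.symm
    linarith

/-- Isometric parametrization of a segment. -/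
theorem seg_param {T : Type*} [MetricSpace T] (hT : IsRTree T) {x y : T} (h : x ≠ y) :
    ∃ f : ℝ → T, f 0 = x ∧ f (dist x y) = y ∧
      (∀ s ∈ Icc 0 (dist x y), ∀ t ∈ Icc 0 (dist x y), dist (f s) (f t) = |s - t|) ∧
      seg x y = f '' Icc 0 (dist x y) := by
  have hd : 0 < dist x y := dist_pos.2 h
  suffices H : ∃ f : ℝ → T, f 0 = x ∧ f (dist x y) = y ∧
      (∀ s ∈ Icc 0 (dist x y), ∀ t ∈ Icc 0 (dist x y), dist (f s) (f t) = |s - t|) by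
    obtain ⟨f, h0, h1, hf⟩ := H
    refine ⟨f, h0, h1, hf, ?_⟩
    obtain ⟨hc, hi⟩ := continuousOn_of_isom f _ hf
    have := seg_eq_image hT f _ _ hd hc hi
    rwa [h0, h1] at this
  obtain ⟨A, hA, -⟩ := hT.arc_existsUnique h
  obtain ⟨a, b, f, hab, hf, him⟩ := hT.arc_isometric h A hA
  obtain ⟨k, -, -, hkA, hk0, hk1⟩ := hA
  have hxA : x ∈ A := by rw [← hkA, ← hk0]; exact ⟨0, by simp, rfl⟩
  have hyA : y ∈ A := by rw [← hkA, ← hk1]; exact ⟨1, by simp, rfl⟩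
  rw [← him] at hxA hyA
  obtain ⟨u, hu, hux⟩ := hxA
  obtain ⟨v, hv, hvy⟩ := hyA
  have hdist : dist x y = |u - v| := by rw [← hux, ← hvy]; exact hf u hu v hv
  rw [hdist]
  obtain ⟨hu0, hu1⟩ := hu
  obtain ⟨hv0, hv1⟩ := hv
  rcases le_total u v with huv | huv
  · have e : |u - v| = v - u := by rw [abs_of_nonpos] <;> linarith
    rw [e]
    refine ⟨fun t => f (u + t), by simpa using hux, by simpa using hvy, ?_⟩
    rintro s ⟨hs0, hs1⟩ t ⟨ht0, ht1⟩
    simp only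
    rw [hf _ ⟨by linarith, by linarith⟩ _ ⟨by linarith, by linarith⟩]
    congr 1; ring
  · have e : |u - v| = u - v := by rw [abs_of_nonneg]; linarith
    rw [e]
    refine ⟨fun t => f (u - t), by simpa using hux, by simpa using hvy, ?_⟩
    rintro s ⟨hs0, hs1⟩ t ⟨ht0, ht1⟩
    simp only
    rw [hf _ ⟨by linarith, by linarith⟩ _ ⟨by linarith, by linarith⟩, abs_sub_comm s t]
    congr 1; ring

theorem dist_of_mem_seg {T : Type*} [MetricSpace T] (hT : IsRTree T) {x y z : T}
    (hz : z ∈ seg x y) : dist x z + dist z y = dist x y := by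
  by_cases h : x = y
  · subst h
    simp only [seg, if_true, mem_singleton_iff] at hz
    simp [hz]
  · obtain ⟨f, h0, h1, hf, him⟩ := seg_param hT h
    rw [him] at hz
    obtain ⟨t, ht, rfl⟩ := hz
    have a1 := hf 0 ⟨le_rfl, dist_nonneg⟩ t ht
    have a2 := hf t ht (dist x y) ⟨dist_nonneg, le_rfl⟩
    rw [h0, abs_of_nonpos (by linarith [ht.1])] at a1
    rw [h1, abs_of_nonpos (by linarith [ht.2])] at a2
    linarith

theorem left_mem_seg {T : Type*} [MetricSpace T] (hT : IsRTree T) (x y : T) : x ∈ seg x y := by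
  by_cases h : x = y
  · simp [seg, h]
  · obtain ⟨f, h0, h1, hf, him⟩ := seg_param hT h
    rw [him]
    exact ⟨0, ⟨le_rfl, dist_nonneg⟩, h0⟩

theorem right_mem_seg {T : Type*} [MetricSpace T] (hT : IsRTree T) (x y : T) : y ∈ seg x y := by
  by_cases h : x = y
  · simp [seg, h]
  · obtain ⟨f, h0, h1, hf, him⟩ := seg_param hT h
    rw [him]
    exact ⟨_, ⟨dist_nonneg, le_rfl⟩, h1⟩

/-- Concatenation of segments meeting only at the common endpoint. -/
theorem seg_concat {T : Type*} [MetricSpace T] (hT : IsRTree T) {x z y : T}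
    (h : ∀ w ∈ seg x z, w ∈ seg z y → w = z) : seg x y = seg x z ∪ seg z y := by
  by_cases hxz : x = z
  · subst hxz
    have : seg x x = {x} := by simp [seg]
    rw [this, eq_comm, union_eq_right, singleton_subset_iff]
    exact left_mem_seg hT _ _
  by_cases hzy : z = y
  · subst hzy
    have : seg z z = {z} := by simp [seg]
    rw [this, eq_comm, union_eq_left, singleton_subset_iff]
    exact right_mem_seg hT _ _
  obtain ⟨f, f0, f1, hf, fim⟩ := seg_param hT hxz
  obtain ⟨k, k0, k1, hk, kim⟩ := seg_param hT hzy
  have d1 : 0 < dist x z := dist_pos.2 hxz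
  have d2 : 0 < dist z y := dist_pos.2 hzy
  generalize dist x z = p at *
  generalize dist z y = q at *
  obtain ⟨fc, fi⟩ := continuousOn_of_isom f _ hf
  obtain ⟨kc, ki⟩ := continuousOn_of_isom k _ hk
  let F : ℝ → T := fun t => if t ≤ p then f t else k (t - p)
  have Fl : ∀ t, t ≤ p → F t = f t := fun t ht => if_pos ht
  have Fr : ∀ t, p ≤ t → F t = k (t - p) := by
    intro t ht
    rcases ht.eq_or_lt with rfl | ht
    · rw [Fl _ le_rfl, f1, sub_self, k0]
    · exact if_neg (not_le.2 ht)
  have hU : Icc 0 (p + q) = Icc 0 p ∪ Icc p (p + q) :=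
    (Icc_union_Icc_eq_Icc d1.le (by linarith)).symm
  have Fc : ContinuousOn F (Icc 0 (p + q)) := by
    rw [hU]
    apply ContinuousOn.union_of_isClosed _ _ isClosed_Icc isClosed_Icc
    · exact fc.congr fun t ht => Fl t ht.2
    · have : ContinuousOn (fun t => k (t - p)) (Icc p (p + q)) :=
        kc.comp (by fun_prop) fun t ht => ⟨by linarith [ht.1], by linarith [ht.2]⟩
      exact this.congr fun t ht => Fr t ht.1
  have cross : ∀ s ∈ Icc 0 p, ∀ t ∈ Icc p (p + q), F s = F t → s = t := by
    intro s hs t ht e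
    have hs' : F s ∈ seg x z := by rw [fim, Fl s hs.2]; exact ⟨s, hs, rfl⟩
    have htI : t - p ∈ Icc 0 q := ⟨by linarith [ht.1], by linarith [ht.2]⟩
    have ht' : F s ∈ seg z y := by rw [e, kim, Fr t ht.1]; exact ⟨t - p, htI, rfl⟩
    have hz := h _ hs' ht'
    have e1 : s = p := by
      apply fi hs ⟨d1.le, le_rfl⟩
      rw [← Fl s hs.2, hz, f1]
    have e2 : t - p = 0 := by
      apply ki htI ⟨le_rfl, d2.le⟩
      rw [← Fr t ht.1, ← e, hz, k0]
    linarith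
  have Fi : InjOn F (Icc 0 (p + q)) := by
    intro s hs t ht e
    rw [hU] at hs ht
    rcases hs with hs | hs <;> rcases ht with ht | ht
    · rw [Fl s hs.2, Fl t ht.2] at e
      exact fi hs ht e
    · exact cross s hs t ht e
    · exact (cross t ht s hs e.symm).symm
    · rw [Fr s hs.1, Fr t ht.1] at e
      have := ki ⟨by linarith [hs.1], by linarith [hs.2]⟩
        ⟨by linarith [ht.1], by linarith [ht.2]⟩ e
      linarith
  have key := seg_eq_image hT F 0 (p + q) (by linarith) Fc Fi
  rw [Fl 0 d1.le, f0, Fr (p + q) (by linarith), add_sub_cancel_left, k1, hU, image_union] at key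
  rw [key, fim, kim]
  congr 1
  · exact image_congr fun t ht => Fl t ht.2
  · ext w
    constructor
    · rintro ⟨t, ht, rfl⟩
      exact ⟨t - p, ⟨by linarith [ht.1], by linarith [ht.2]⟩, (Fr t ht.1).symm⟩
    · rintro ⟨t, ht, rfl⟩
      refine ⟨p + t, ⟨by linarith [ht.1], by linarith [ht.2]⟩, ?_⟩
      rw [Fr _ (by linarith [ht.1]), add_sub_cancel_left]

theorem mem_seg_iff {T : Type*} [MetricSpace T] (hT : IsRTree T) {x y z : T} :
    z ∈ seg x y ↔ dist x z + dist z y = dist x y := by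
  refine ⟨dist_of_mem_seg hT, fun h => ?_⟩
  rw [seg_concat hT (z := z)]
  · exact Or.inl (right_mem_seg hT _ _)
  · intro w h1 h2
    have e1 := dist_of_mem_seg hT h1
    have e2 := dist_of_mem_seg hT h2
    have e3 := dist_triangle x w y
    have e4 := dist_comm w z
    have e5 : 0 ≤ dist w z := dist_nonneg
    exact dist_eq_zero.1 (by linarith)

theorem seg_comparable {T : Type*} [MetricSpace T] (hT : IsRTree T) {x a p q : T}
    (hp : p ∈ seg x a) (hq : q ∈ seg x a) : p ∈ seg q a ∨ q ∈ seg p a := by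
  by_cases h : x = a
  · subst h
    have : seg x x = {x} := by simp [seg]
    rw [this, mem_singleton_iff] at hp hq
    subst hp hq
    exact Or.inl (left_mem_seg hT _ _)
  obtain ⟨f, f0, f1, hf, fim⟩ := seg_param hT h
  have key : ∀ s ∈ Icc 0 (dist x a), ∀ t ∈ Icc 0 (dist x a), s ≤ t → f t ∈ seg (f s) a := by
    intro s hs t ht hst
    have hr : dist x a ∈ Icc 0 (dist x a) := ⟨dist_nonneg, le_rfl⟩
    have a1 := hf s hs t ht
    have a2 := hf t ht _ hr
    have a3 := hf s hs _ hr
    rw [abs_of_nonpos (by linarith)] at a1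
    rw [f1, abs_of_nonpos (by linarith [ht.2])] at a2
    rw [f1, abs_of_nonpos (by linarith [hs.2])] at a3
    rw [mem_seg_iff hT]
    linarith
  rw [fim] at hp hq
  obtain ⟨s, hs, rfl⟩ := hp
  obtain ⟨t, ht, rfl⟩ := hq
  rcases le_total s t with hst | hst
  · exact Or.inr (key s hs t ht hst)
  · exact Or.inl (key t ht s hs hst)

theorem smul_mem_seg_iff {T : Type*} [MetricSpace T] (hT : IsRTree T)
    {G : Type*} [Group G] [MulAction G T] (hact : ActsByWeakHomeos G T) (g : G) (x y z : T) :
    g • z ∈ seg (g • x) (g • y) ↔ z ∈ seg x y := by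
  have hB := (hact g).2 z x y
  by_cases h1 : z = x
  · subst h1
    exact iff_of_true (left_mem_seg hT _ _) (left_mem_seg hT _ _)
  by_cases h2 : z = y
  · subst h2
    exact iff_of_true (right_mem_seg hT _ _) (right_mem_seg hT _ _)
  simp only [Btwn, ne_eq, smul_left_cancel_iff, h1, h2, not_false_eq_true, and_true] at hB
  exact hB.symm

/-- Non-nesting: a point moved towards a fixed point is fixed. -/
theorem smul_eq_of_mem {T : Type*} [MetricSpace T] (hT : IsRTree T)
    {G : Type*} [Group G] [MulAction G T] (hact : ActsByWeakHomeos G T) (hnn : NonNesting G T)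
    (g : G) {a q : T} (ha : g • a = a) (hq : g • q ∈ seg q a) : g • q = q := by
  have hsub : ∀ w ∈ seg (g • q) a, w ∈ seg q a := by
    intro w hw
    rw [mem_seg_iff hT] at *
    have := dist_triangle q (g • q) w
    have := dist_triangle q w a
    linarith
  have himg : ∀ w ∈ seg q a, g • w ∈ seg (g • q) a := by
    intro w hw
    have := (smul_mem_seg_iff hT hact g q a w).2 hw
    rwa [ha] at this
  by_contra hne
  apply hnn g q a
  refine ⟨?_, fun hcon => hne ?_⟩
  · rintro _ ⟨w, hw, rfl⟩
    exact hsub _ (himg w hw)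
  · obtain ⟨w, hw, hwq⟩ := hcon (left_mem_seg hT q a)
    have h3 := himg w hw
    simp only at hwq
    rw [hwq, mem_seg_iff hT] at h3
    rw [mem_seg_iff hT] at hq
    have := dist_comm q (g • q)
    have h5 : 0 ≤ dist (g • q) q := dist_nonneg
    exact dist_eq_zero.1 (by linarith)

/-- For a non-nesting action by weak homeomorphisms on an `ℝ`-tree,
if `g` is elliptic and `x ∉ T^g`, then `[x, g x] ∩ T^g = {a}`, where `a` is the
projection of `x` onto `T^g`. -/
theorem seg_inter_fixedSet_eq_proj
    {T : Type*} [MetricSpace T] (hT : IsRTree T)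
    {G : Type*} [Group G] [MulAction G T]
    (hact : ActsByWeakHomeos G T) (hnn : NonNesting G T)
    (g : G) (hg : ∃ t : T, g • t = t) (x a : T)
    (hx : x ∉ fixedSet T g) (ha : a ∈ fixedSet T g)
    (hproj : ∀ y ∈ fixedSet T g, seg x a ⊆ seg x y) :
    seg x (g • x) ∩ fixedSet T g = {a} := by
  have ha' : g • a = a := ha
  have huniq : ∀ y, g • y = y → y ∈ seg x a → y = a := by
    intro y hy hya
    have h1 := hproj y hy (right_mem_seg hT x a)
    rw [mem_seg_iff hT] at h1 hya
    have := dist_comm y a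
    have h5 : 0 ≤ dist y a := dist_nonneg
    exact dist_eq_zero.1 (by linarith)
  have hpull : ∀ w, w ∈ seg a (g • x) → g⁻¹ • w ∈ seg x a := by
    intro w hw
    have h1 : g • (g⁻¹ • w) ∈ seg (g • x) (g • a) := by
      rw [smul_inv_smul, ha']
      rw [mem_seg_iff hT] at hw ⊢
      rw [dist_comm (g • x) w, dist_comm w a, dist_comm (g • x) a]
      linarith
    exact (smul_mem_seg_iff hT hact g x a _).1 h1
  have hcat : seg x (g • x) = seg x a ∪ seg a (g • x) := by
    apply seg_concat hT
    intro p hp1 hp2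
    have hq := hpull p hp2
    have hainv : g⁻¹ • a = a := by rw [inv_smul_eq_iff, ha']
    have hfix : g • p = p := by
      rcases seg_comparable hT hp1 hq with h | h
      · have := smul_eq_of_mem hT hact hnn g (a := a) (q := g⁻¹ • p) ha'
          (by rwa [smul_inv_smul])
        rw [smul_inv_smul] at this
        exact (eq_inv_smul_iff.1 this)
      · have := smul_eq_of_mem hT hact hnn g⁻¹ hainv h
        exact (inv_smul_eq_iff.1 this).symm
    exact huniq p hfix hp1
  ext y
  rw [hcat, mem_singleton_iff]
  constructor
  · rintro ⟨h | h, hy⟩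
    · exact huniq y hy h
    · have hy' : g • y = y := hy
      have h1 := hpull y h
      rw [inv_smul_eq_iff.2 hy'.symm] at h1
      exact huniq y hy' h1
  · rintro rfl
    exact ⟨Or.inl (right_mem_seg hT _ _), ha⟩
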